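/- Let K be a field of characteristic ≠ 2 in which -1 is a square, and A a central simple algebra over K whose degree is a power of 2. If the trace form T_A(z) = Trd_A(z²) is not hyperbolic, then A is a division algebra. -/

import Mathlib

/-- On a simple ring, a linear functional vanishing on commutators and not at `1` induces a
nondegenerate pairing `(x, y) ↦ τ (x * y)`. -/
theorem IsSimpleRing.eq_zero_of_forall_apply_mul_eq_zero {K B : Type*} [CommRing K] [Ring B]
    [Algebra K B] [IsSimpleRing B] (τ : B →ₗ[K] K) (hτ : ∀ x y, τ (x * y) = τ (y * x))
    (h1 : τ 1 ≠ 0) {x : B} (hx : ∀ y, τ (x * y) = 0) : x = 0 := by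
  let I : TwoSidedIdeal B := TwoSidedIdeal.mk' {x | ∀ y, τ (x * y) = 0}
    (by simp) (fun ha hb y => by rw [add_mul, map_add, ha, hb, add_zero])
    (fun ha y => by rw [neg_mul, map_neg, ha, neg_zero])
    (fun {a b} hb y => by rw [mul_assoc, hτ, mul_assoc]; exact hb _)
    (fun {a b} ha y => by rw [mul_assoc]; exact ha _)
  have hI : ∀ z, z ∈ I ↔ ∀ y, τ (z * y) = 0 := fun z => TwoSidedIdeal.mem_mk' _ _ _ _ _ _ z
  have hxI : x ∈ I := (hI x).2 hx
  rcases IsSimpleRing.simple.eq_bot_or_eq_top I with h | h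
  · simpa [h] using hxI
  · have h1I : (1 : B) ∈ I := by simp [h]
    exact absurd (by simpa using (hI 1).1 h1I 1) h1

/-- A functional on a matrix ring that vanishes on commutators factors through the trace. -/
theorem Matrix.apply_eq_apply_single_trace {K B ι : Type*} [CommRing K] [Ring B] [Algebra K B]
    [Fintype ι] [DecidableEq ι] (t : Matrix ι ι B →ₗ[K] K) (ht : ∀ x y, t (x * y) = t (y * x))
    (c : ι) (M : Matrix ι ι B) : t M = t (Matrix.single c c M.trace) := by
  have key : ∀ a b x, t (Matrix.single a b x) = if a = b then t (Matrix.single c c x) else 0 := by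
    intro a b x
    have h : Matrix.single a b x = Matrix.single a c x * Matrix.single c b (1 : B) := by simp
    rw [h, ht]
    split_ifs with hab
    · subst hab; simp
    · rw [Matrix.single_mul_single_of_ne _ _ _ _ (Ne.symm hab), map_zero]
  have hs : Matrix.single c c M.trace = ∑ a, Matrix.single c c (M a a) := by
    rw [Matrix.trace]
    exact map_sum (Matrix.singleAddMonoidHom c c) _ _
  conv_lhs => rw [Matrix.matrix_eq_sum_single M]
  simp only [hs, map_sum]
  refine Finset.sum_congr rfl fun a _ => ?_
  rw [Finset.sum_congr rfl fun b _ => key a b (M a b)]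
  simp only [Finset.sum_ite_eq, Finset.mem_univ, if_true]

/-- For a nondegenerate bilinear form `β` on `U`, the quadratic form `(u, v) ↦ β u v` on `U × U` is
hyperbolic. -/
theorem LinearMap.BilinForm.Nondegenerate.exists_hyperbolic_coordinates {K U : Type*} [Field K]
    (h2 : (2 : K) ≠ 0) [AddCommGroup U] [Module K U] [FiniteDimensional K U]
    {β : LinearMap.BilinForm K U} (hβ : β.Nondegenerate) {N : ℕ} (hN : Module.finrank K U = N) :
    ∃ e : (U × U) ≃ₗ[K] (Fin N × Fin 2 → K), ∀ w : U × U,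
      β w.1 w.2 = ∑ p, (if p.2 = 0 then (1 : K) else -1) * (e w p) ^ 2 := by
  let b : Module.Basis (Fin N) K U := Module.finBasisOfFinrankEq K U hN
  let b' := β.dualBasis hβ b
  let f : ((Fin N → K) × (Fin N → K)) ≃ₗ[K] (Fin N × Fin 2 → K) :=
    { toFun := fun w p => if p.2 = 0 then (w.1 p.1 + w.2 p.1) / 2 else (w.1 p.1 - w.2 p.1) / 2
      map_add' := fun v w => by
        ext p
        simp only [Prod.fst_add, Prod.snd_add, Pi.add_apply]
        split_ifs <;> ring
      map_smul' := fun c w => by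
        ext p
        simp only [Prod.smul_fst, Prod.smul_snd, Pi.smul_apply, smul_eq_mul, RingHom.id_apply]
        split_ifs <;> ring
      invFun := fun x => (fun i => x (i, 0) + x (i, 1), fun i => x (i, 0) - x (i, 1))
      left_inv := fun w => by
        ext i <;> simp <;> field_simp <;> ring
      right_inv := fun x => by
        ext ⟨i, j⟩
        fin_cases j <;> simp <;> field_simp <;> ring }
  refine ⟨(b'.equivFun.prodCongr b.equivFun).trans f, fun w => ?_⟩
  have hsum : β w.1 w.2 = ∑ i, b'.repr w.1 i * b.repr w.2 i := by
    conv_lhs => rw [← b.sum_repr w.2]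
    simp only [b', map_sum, map_smul, smul_eq_mul, LinearMap.BilinForm.dualBasis_repr_apply,
      mul_comm]
  rw [hsum, Fintype.sum_prod_type]
  refine Finset.sum_congr rfl fun i _ => ?_
  simp [f]
  field_simp
  ring

/-- If `-1` is a square, the quadratic form `z ↦ t (z * z)` attached to a functional `t` on
`M₂(B)`, with `B` simple, that vanishes on commutators and not at `1`, is hyperbolic. -/
theorem Matrix.exists_hyperbolic_coordinates {K B : Type*} [Field K] (h2 : (2 : K) ≠ 0)
    (hsq : IsSquare (-1 : K)) [Ring B] [Algebra K B] [IsSimpleRing B] [FiniteDimensional K B]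
    (t : Matrix (Fin 2) (Fin 2) B →ₗ[K] K) (ht : ∀ x y, t (x * y) = t (y * x)) (ht1 : t 1 ≠ 0)
    {N : ℕ} (hN : 2 * Module.finrank K B = N) :
    ∃ e : Matrix (Fin 2) (Fin 2) B ≃ₗ[K] (Fin N × Fin 2 → K), ∀ z,
      t (z * z) = ∑ p, (if p.2 = 0 then (1 : K) else -1) * (e z p) ^ 2 := by
  obtain ⟨i, hi⟩ := hsq
  have hi0 : i ≠ 0 := by rintro rfl; simp at hi
  let τ : B →ₗ[K] K := t ∘ₗ Matrix.singleLinearMap K 0 0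
  have htτ : ∀ M, t M = τ (M 0 0) + τ (M 1 1) := fun M => by
    rw [Matrix.apply_eq_apply_single_trace t ht 0 M, Matrix.trace_fin_two, ← map_add]
    rfl
  have hτ : ∀ x y, τ (x * y) = τ (y * x) := fun x y => by
    have := ht (Matrix.single 0 0 x) (Matrix.single 0 0 y)
    simpa [τ] using this
  have hτ1 : τ 1 ≠ 0 := fun h => ht1 (by simp [htτ, h])
  have hdet : ∀ {x : B}, (∀ y, τ (x * y) = 0) → x = 0 := fun {x} =>
    IsSimpleRing.eq_zero_of_forall_apply_mul_eq_zero τ hτ hτ1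
  let γ : LinearMap.BilinForm K B := (LinearMap.mul K B).compr₂ τ
  let β : LinearMap.BilinForm K (B × B) :=
    γ.compl₁₂ (LinearMap.fst K B B) (LinearMap.fst K B B) +
      (2 : K) • γ.compl₁₂ (LinearMap.snd K B B) (LinearMap.snd K B B)
  have hβa : ∀ u v, β u v = τ (u.1 * v.1) + 2 * τ (u.2 * v.2) := fun u v => rfl
  have hβs : ∀ u v, β u v = β v u := fun u v => by rw [hβa, hβa, hτ u.1, hτ u.2]
  have hsep : ∀ u, (∀ v, β u v = 0) → u = 0 := fun u hu => by
    refine Prod.ext (hdet fun y => ?_) (hdet fun y => ?_)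
    · simpa [hβa] using hu (y, 0)
    · simpa [hβa, h2] using hu (0, y)
  have hβ : β.Nondegenerate := ⟨hsep, fun u hu => hsep u fun v => by rw [hβs, hu]⟩
  obtain ⟨e, he⟩ := hβ.exists_hyperbolic_coordinates h2
    (N := N) (by rw [Module.finrank_prod, ← hN, two_mul])
  let g : Matrix (Fin 2) (Fin 2) B ≃ₗ[K] ((B × B) × (B × B)) :=
    { toFun := fun M => ((M 0 0 + i • M 1 1, M 0 1), (M 0 0 - i • M 1 1, M 1 0))
      map_add' := fun M M' => by
        ext <;> simp <;> abel
      map_smul' := fun c M => by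
        ext <;> simp [smul_comm c i, smul_sub]
      invFun := fun w => !![(2 : K)⁻¹ • (w.1.1 + w.2.1), w.1.2;
        w.2.2, (2 * i)⁻¹ • (w.1.1 - w.2.1)]
      left_inv := fun M => by
        ext a b
        fin_cases a <;> fin_cases b <;> simp
        all_goals
          match_scalars
          field_simp
          norm_num
      right_inv := fun w => by
        have h : i * (2 * i)⁻¹ = (2 : K)⁻¹ := by field_simp
        have h' : ∀ x : B, (2 : K)⁻¹ • x + (2 : K)⁻¹ • x = x := fun x => by
          rw [← two_smul K, smul_inv_smul₀ h2]
        ext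
        · simp only [Matrix.of_apply, Matrix.cons_val', Matrix.cons_val_zero, Matrix.cons_val_one,
            Matrix.cons_val_fin_one, smul_smul, h]
          rw [← smul_add, add_add_sub_cancel, smul_add, h']
        · simp
        · simp only [Matrix.of_apply, Matrix.cons_val', Matrix.cons_val_zero, Matrix.cons_val_one,
            Matrix.cons_val_fin_one, smul_smul, h]
          rw [← smul_sub, add_sub_sub_cancel, smul_add, h']
        · simp }
  refine ⟨g.trans e, fun z => ?_⟩
  have hz : t (z * z) = β (g z).1 (g z).2 := by
    have hmul : (z 0 0 + i • z 1 1) * (z 0 0 - i • z 1 1) =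
        z 0 0 * z 0 0 + z 1 1 * z 1 1 + i • (z 1 1 * z 0 0 - z 0 0 * z 1 1) := by
      simp only [add_mul, mul_sub, smul_mul_assoc, mul_smul_comm]
      match_scalars <;> simp [← hi]
    have hg : g z = ((z 0 0 + i • z 1 1, z 0 1), (z 0 0 - i • z 1 1, z 1 0)) := rfl
    rw [hβa, hg, hmul, htτ]
    simp only [Matrix.mul_apply, Fin.sum_univ_two, map_add, map_smul, map_sub]
    rw [hτ (z 1 1) (z 0 0), hτ (z 1 0) (z 0 1), sub_self, smul_zero]
    ring
  rw [hz, he]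
  rfl

/-- Let `K` be a field of characteristic ≠ 2 in which `-1` is a square, and `A` a
central simple `K`-algebra of degree `2^m`.  If the trace form
`T_A(z) = Trd_A(z²) = (2^m)⁻¹·Tr(left mult. by z²)` is not hyperbolic, then `A`
is a division algebra. -/
theorem division_of_traceForm_not_hyperbolic (K : Type*) [Field K]
    (hchar2 : ringChar K ≠ 2) (hsq : IsSquare (-1 : K))
    (A : Type*) [Ring A] [Algebra K A] [Algebra.IsCentral K A] [IsSimpleRing A]
    [FiniteDimensional K A] (m : ℕ) (hdeg : Module.finrank K A = (2 ^ m) ^ 2)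
    (hnothyp : ¬ ∃ e : A ≃ₗ[K] (Fin ((2 ^ m) ^ 2 / 2) × Fin 2 → K),
      ∀ z : A,
        ((2 : K) ^ m)⁻¹ * LinearMap.trace K A (LinearMap.mulLeft K (z * z)) =
          ∑ p, (if p.2 = 0 then (1 : K) else -1) * (e z p) ^ 2) :
    ∀ s : A, s ≠ 0 → IsUnit s := by
  have h2 : (2 : K) ≠ 0 := Ring.two_ne_zero hchar2
  have : IsArtinianRing A := IsArtinianRing.of_finite K A
  obtain ⟨n, hn, D, _, _, _, ⟨φ⟩⟩ := IsSimpleRing.exists_algEquiv_matrix_divisionRing_finite K A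
  have hfin : n * n * Module.finrank K D = 2 ^ (m * 2) := by
    rw [pow_mul, ← hdeg, φ.toLinearEquiv.finrank_eq, Module.finrank_matrix]
    simp
  obtain ⟨k, -, rfl⟩ := (Nat.dvd_prime_pow Nat.prime_two).1
    (Dvd.intro _ ((mul_assoc _ _ _).symm.trans hfin))
  rcases k with _ | k
  · let : Unique (Fin (2 ^ 0)) := inferInstanceAs (Unique (Fin 1))
    have hψ : Nonempty (Matrix (Fin (2 ^ 0)) (Fin (2 ^ 0)) D ≃ₐ[K] D) := by
      convert Nonempty.intro (Matrix.uniqueAlgEquiv (m := Fin (2 ^ 0)) (A := D) (R := K))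
    obtain ⟨ψ⟩ := hψ
    exact fun s hs => (isUnit_map_iff (φ.trans ψ) s).1
      (isUnit_iff_ne_zero.2 ((map_ne_zero_iff _ (φ.trans ψ).injective).2 hs))
  · have hcard : 2 ^ (k + 1) = 2 * 2 ^ k := by ring
    let ψ : A ≃ₐ[K] Matrix (Fin 2) (Fin 2) (Matrix (Fin (2 ^ k)) (Fin (2 ^ k)) D) :=
      φ.trans ((Matrix.reindexAlgEquiv K D
        ((finCongr hcard).trans finProdFinEquiv.symm)).trans
          (Matrix.compAlgEquiv (Fin 2) (Fin (2 ^ k)) D K).symm)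
    let t : A →ₗ[K] K := ((2 : K) ^ m)⁻¹ • (LinearMap.trace K A ∘ₗ LinearMap.mul K A)
    have ht : ∀ a, t a = ((2 : K) ^ m)⁻¹ * LinearMap.trace K A (LinearMap.mulLeft K a) :=
      fun a => rfl
    have htc : ∀ a b, t (a * b) = t (b * a) := fun a b => by
      simp only [ht, LinearMap.mulLeft_mul]
      rw [LinearMap.trace_comp_comm']
    have ht1 : t 1 ≠ 0 := by
      rw [ht, LinearMap.mulLeft_one, LinearMap.trace_id, hdeg]
      simp [h2]
    have hN : 2 * Module.finrank K (Matrix (Fin (2 ^ k)) (Fin (2 ^ k)) D) =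
        (2 ^ m) ^ 2 / 2 := by
      rw [← pow_mul, ← hfin, Module.finrank_matrix, Fintype.card_fin, eq_comm]
      refine Nat.div_eq_of_eq_mul_left two_pos ?_
      ring
    obtain ⟨e, he⟩ := Matrix.exists_hyperbolic_coordinates h2 hsq (t ∘ₗ ψ.symm.toLinearMap)
      (fun x y => by simp [htc]) (by simpa using ht1) hN
    refine absurd ⟨ψ.toLinearEquiv.trans e, fun z => ?_⟩ hnothyp
    rw [← ht]
    simpa using he (ψ z)
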